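/- Let G = (V, E) be a finite simple undirected graph with n = |V| vertices, let S ⊆ V be an independent set with |S| = T where 1 ≤ T ≤ n, and set C = n − T + 1. Then any enumeration v_1, …, v_n of V that lists all vertices of V \ S in the first n − T positions and all vertices of S in the last T positions, when loaded into an initially empty cache of capacity C under the LIFO eviction policy, covers every edge of G. -/

import Mathlib

/-- The cache state (as a stack, most recently loaded first) after loading the
vertices of `l` in order into an initially empty cache of capacity `C` under
the LIFO eviction policy: if the cache is full, the most recently loaded
cached vertex (the head of the stack) is evicted. -/
def lifoRun {V : Type*} (C : ℕ) (l : List V) : List V :=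
  l.foldl (fun s x => if s.length < C then x :: s else x :: s.tail) []

/-- A pair of vertices `u, w` is covered by the LIFO schedule of load sequence `l`
with capacity `C` if at some moment both are in the cache simultaneously. -/
def coveredLIFO {V : Type*} (C : ℕ) (l : List V) (u w : V) : Prop :=
  ∃ i ≤ l.length, u ∈ lifoRun C (l.take i) ∧ w ∈ lifoRun C (l.take i)

theorem lifoRun_append_singleton {V : Type*} (C : ℕ) (l : List V) (x : V) :
    lifoRun C (l ++ [x]) =
      if (lifoRun C l).length < C then x :: lifoRun C l else x :: (lifoRun C l).tail := by
  rw [lifoRun, List.foldl_append]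
  rfl

/-- Nothing is evicted while the load sequence fits in the cache. -/
theorem lifoRun_of_length_le {V : Type*} {C : ℕ} (l : List V) (h : l.length ≤ C) :
    lifoRun C l = l.reverse := by
  induction l using List.reverseRecOn with
  | nil => rfl
  | append_singleton l x ih =>
    simp only [List.length_append, List.length_singleton] at h
    rw [lifoRun_append_singleton, ih (by omega), if_pos (by simp; omega)]
    simp

/-- With capacity `p.length + 1`, the prefix `p` stays cached forever and a single slot is
overwritten by each later load. -/
theorem lifoRun_append_append_singleton {V : Type*} (p q : List V) (x : V) :
    lifoRun (p.length + 1) (p ++ q ++ [x]) = x :: p.reverse := by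
  induction q using List.reverseRecOn generalizing x with
  | nil => rw [lifoRun_of_length_le _ (by simp)]; simp
  | append_singleton q y ih =>
    rw [lifoRun_append_singleton, ← List.append_assoc, ih, if_neg (by simp)]
    simp

theorem lifoRun_take_succ {V : Type*} {m k : ℕ} (l : List V) (hmk : m ≤ k) (hk : k < l.length) :
    lifoRun (m + 1) (l.take (k + 1)) = l[k] :: (l.take m).reverse := by
  have hsplit : l.take (k + 1) = l.take m ++ (l.take k).drop m ++ [l[k]] := by
    rw [List.take_succ_eq_append_getElem hk]
    congr 1
    conv_lhs => rw [← List.take_append_drop m (l.take k)]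
    rw [List.take_take, min_eq_left hmk]
  have hlen : (l.take m).length = m := by simp; omega
  rw [hsplit]
  simpa only [hlen] using lifoRun_append_append_singleton (l.take m) ((l.take k).drop m) l[k]

theorem coveredLIFO_symm {V : Type*} {C : ℕ} {l : List V} {u w : V}
    (h : coveredLIFO C l u w) : coveredLIFO C l w u := by
  obtain ⟨i, hi, hu, hw⟩ := h
  exact ⟨i, hi, hw, hu⟩

/-- An entry among the first `m` loads is covered together with every other entry. -/
theorem coveredLIFO_getElem {V : Type*} {m a b : ℕ} (l : List V) (hm : m < l.length)
    (ha : a < m) (hb : b < l.length) :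
    coveredLIFO (m + 1) l l[a] l[b] := by
  have mem_take : ∀ c (hc : c < m), l[c] ∈ l.take m := fun c hc =>
    List.mem_take_iff_getElem.2 ⟨c, by omega, rfl⟩
  rcases lt_or_ge b m with hbm | hbm
  · refine ⟨m + 1, hm, ?_⟩
    rw [lifoRun_take_succ l le_rfl hm]
    simp [mem_take a ha, mem_take b hbm]
  · refine ⟨b + 1, hb, ?_⟩
    rw [lifoRun_take_succ l hbm hb]
    simp [mem_take a ha]

/-- Forward direction of the reduction in Theorem 4.2: let `G` be a finite simple
graph on `n` vertices, `S` an independent set with `|S| = T` (`1 ≤ T ≤ n`), and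
`C = n - T + 1`.  Any enumeration `e` of the vertices that lists all vertices of
`V \ S` in the first `n - T` positions and all vertices of `S` in the last `T`
positions (i.e. `e j ∈ S ↔ n - T ≤ j`), loaded into an initially empty LIFO
cache of capacity `C`, covers every edge of `G`. -/
theorem lifo_indep_ordering_covers {V : Type*} [Fintype V] [DecidableEq V]
    (G : SimpleGraph V) (n T : ℕ) (hn : n = Fintype.card V)
    (hT1 : 1 ≤ T) (hTn : T ≤ n)
    (S : Finset V) (hScard : S.card = T)
    (hSind : ∀ u ∈ S, ∀ w ∈ S, ¬ G.Adj u w)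
    (e : Fin n ≃ V) (he : ∀ j : Fin n, e j ∈ S ↔ n - T ≤ j.val) :
    ∀ u w : V, G.Adj u w →
      coveredLIFO (n - T + 1) (List.ofFn fun j => e j) u w := by
  have key : ∀ i j : Fin n, i.val < n - T →
      coveredLIFO (n - T + 1) (List.ofFn fun j => e j) (e i) (e j) := fun i j hi => by
    simpa using coveredLIFO_getElem (List.ofFn fun j => e j) (m := n - T) (a := i) (b := j)
      (by simp; omega) hi (by simp)
  intro u w huw
  obtain ⟨i, rfl⟩ := e.surjective u
  obtain ⟨j, rfl⟩ := e.surjective w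
  rcases lt_or_ge i.val (n - T) with hi | hi
  · exact key i j hi
  rcases lt_or_ge j.val (n - T) with hj | hj
  · exact coveredLIFO_symm (key j i hj)
  · exact absurd huw (hSind _ ((he i).2 hi) _ ((he j).2 hj))
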